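/- arXiv:2303.12989 — 3 statements merged into one kernel-verified Lean document; each statement's English description precedes it below -/
import Mathlib

section
/- Let x⁺ be the OPG update from the point x with step size η > 0, i.e., x⁺ is a minimizer over X of the map y ↦ r(y) + ⟨g, y⟩ + (1/(2η))‖y − x‖², where g is a subgradient of f at x. Then, for every comparator u ∈ X and every subgradient h of r at x, one has f(x) + r(x) − f(u) − r(u) ≤ (1/2)(1/η − μ)‖u − x‖² − (1/(2η))‖u − x⁺‖² + (η/2)‖g + h‖². -/
open scoped RealInnerProductSpace

/-- `g` is a subgradient of `φ` at `x` relative to the set `X`. -/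
def IsSubgrad {n : ℕ} (X : Set (EuclideanSpace ℝ (Fin n)))
    (φ : EuclideanSpace ℝ (Fin n) → ℝ) (x g : EuclideanSpace ℝ (Fin n)) : Prop :=
  ∀ y ∈ X, φ y ≥ φ x + ⟪g, y - x⟫

/-- `φ` is `μ`-strongly convex on `X` (in the subgradient sense). -/
def StronglyConvexOnSet {n : ℕ} (X : Set (EuclideanSpace ℝ (Fin n)))
    (φ : EuclideanSpace ℝ (Fin n) → ℝ) (μ : ℝ) : Prop :=
  ∀ x ∈ X, ∀ y ∈ X, ∀ g : EuclideanSpace ℝ (Fin n),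
    IsSubgrad X φ x g → φ y ≥ φ x + ⟪g, y - x⟫ + μ / 2 * ‖y - x‖ ^ 2

set_option autoImplicit false

/-- A minimizer of a convex function plus a quadratic satisfies a quadratic growth bound. -/
theorem ConvexOn.add_sq_norm_sub_le_of_isMinOn {E : Type*} [NormedAddCommGroup E]
    [InnerProductSpace ℝ E] {X : Set E} {φ : E → ℝ} (hφ : ConvexOn ℝ X φ) {c : ℝ}
    {x p u : E} (hp : p ∈ X) (hu : u ∈ X)
    (hmin : IsMinOn (fun y => φ y + c * ‖y - x‖ ^ 2) X p) :
    φ p + c * ‖p - x‖ ^ 2 + c * ‖u - p‖ ^ 2 ≤ φ u + c * ‖u - x‖ ^ 2 := by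
  set A := φ u + c * ‖u - x‖ ^ 2 - (φ p + c * ‖p - x‖ ^ 2) with hA
  set B := c * ‖u - p‖ ^ 2 with hB
  have key : ∀ t : ℝ, 0 < t → t ≤ 1 → (1 - t) * B ≤ A := by
    intro t ht ht1
    have h1 := isMinOn_iff.1 hmin _ (hφ.1 hp hu (sub_nonneg.2 ht1) ht.le (by ring))
    have h2 := hφ.2 hp hu (sub_nonneg.2 ht1) ht.le (by ring)
    have h3 : ‖(1 - t) • p + t • u - x‖ ^ 2 =
        (1 - t) * ‖p - x‖ ^ 2 + t * ‖u - x‖ ^ 2 - t * (1 - t) * ‖u - p‖ ^ 2 := by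
      have e1 : (1 - t) • p + t • u - x = (1 - t) • (p - x) + t • (u - x) := by module
      have e2 : u - p = (u - x) - (p - x) := by abel
      rw [e1, e2, norm_add_sq_real, norm_sub_sq_real (u - x), norm_smul, norm_smul,
        real_inner_smul_left, real_inner_smul_right, real_inner_comm (u - x) (p - x),
        mul_pow, mul_pow, Real.norm_eq_abs, Real.norm_eq_abs, sq_abs, sq_abs]
      ring
    simp only [smul_eq_mul] at h1 h2
    rw [h3] at h1
    refine le_of_mul_le_mul_left ?_ ht
    rw [hA, hB]
    linarith
  have hA0 : 0 ≤ A := by simpa using key 1 one_pos le_rfl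
  suffices B ≤ A by linarith
  by_contra! hlt
  have hB0 : 0 < B := hA0.trans_lt hlt
  have h := key ((B - A) / (2 * B)) (by have := sub_pos.2 hlt; positivity)
    (by rw [div_le_one (by positivity)]; linarith)
  have e : (1 - (B - A) / (2 * B)) * B = (B + A) / 2 := by field_simp; ring
  linarith

/-- Young's inequality for the inner product, with weight `η`. -/
theorem real_inner_le_mul_sq_add_mul_sq {E : Type*} [NormedAddCommGroup E]
    [InnerProductSpace ℝ E] {η : ℝ} (hη : 0 < η) (a b : E) :
    ⟪a, b⟫ ≤ η / 2 * ‖a‖ ^ 2 + 1 / (2 * η) * ‖b‖ ^ 2 := by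
  have h := norm_sub_sq_real (η • a) b
  rw [norm_smul, mul_pow, Real.norm_eq_abs, sq_abs, real_inner_smul_left] at h
  have e : η / 2 * ‖a‖ ^ 2 + 1 / (2 * η) * ‖b‖ ^ 2 - ⟪a, b⟫ =
      1 / (2 * η) * ‖η • a - b‖ ^ 2 := by
    rw [h]
    field_simp
    ring
  have : 0 ≤ 1 / (2 * η) * ‖η • a - b‖ ^ 2 := by positivity
  linarith

theorem opg_one_step_bound {n : ℕ} (X : Set (EuclideanSpace ℝ (Fin n)))
    (hXne : X.Nonempty) (hXconv : Convex ℝ X) (hXcomp : IsCompact X)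
    (f r : EuclideanSpace ℝ (Fin n) → ℝ) (μ : ℝ) (hμ : 0 ≤ μ)
    (hfconv : ConvexOn ℝ X f) (hrconv : ConvexOn ℝ X r)
    (hfstrong : StronglyConvexOnSet X f μ)
    (η : ℝ) (hη : 0 < η)
    (x xp : EuclideanSpace ℝ (Fin n)) (hx : x ∈ X) (hxp : xp ∈ X)
    (g : EuclideanSpace ℝ (Fin n)) (hg : IsSubgrad X f x g)
    (hmin : ∀ y ∈ X,
      r xp + ⟪g, xp⟫ + 1 / (2 * η) * ‖xp - x‖ ^ 2 ≤
        r y + ⟪g, y⟫ + 1 / (2 * η) * ‖y - x‖ ^ 2) :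
    ∀ u ∈ X, ∀ h : EuclideanSpace ℝ (Fin n), IsSubgrad X r x h →
      f x + r x - f u - r u ≤
        1 / 2 * (1 / η - μ) * ‖u - x‖ ^ 2 - 1 / (2 * η) * ‖u - xp‖ ^ 2 +
          η / 2 * ‖g + h‖ ^ 2 := by
  intro u hu h hh
  have hφ : ConvexOn ℝ X fun y => r y + ⟪g, y⟫ :=
    hrconv.add ((innerₗ (EuclideanSpace ℝ (Fin n)) g).convexOn hXconv)
  have hgrowth := hφ.add_sq_norm_sub_le_of_isMinOn (c := 1 / (2 * η)) hxp hu
    (isMinOn_iff.2 hmin)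
  have hf := hfstrong x hx u hu g hg
  have hr := hh xp hxp
  have hyoung := real_inner_le_mul_sq_add_mul_sq hη (g + h) (x - xp)
  rw [norm_sub_rev x xp] at hyoung
  simp only [inner_add_left, inner_sub_right] at hf hr hyoung
  have e : 1 / 2 * (1 / η - μ) * ‖u - x‖ ^ 2 =
      1 / (2 * η) * ‖u - x‖ ^ 2 - μ / 2 * ‖u - x‖ ^ 2 := by
    field_simp
  linarith
end

section
/- Let x, x⁺ ∈ X, η > 0, let g be a subgradient of f at x where f is μ-strongly convex on X (μ ≥ 0), let h be a subgradient of r at x and h⁺ a subgradient of r at x⁺, and assume the first-order optimality condition: for all y ∈ X, 0 ≤ ⟨y − x⁺, g + h⁺ + (1/η)(x⁺ − x)⟩. Then for every u ∈ X, f(x) + r(x) − f(u) − r(u) ≤ (1/η)⟨x⁺ − x, u − x⁺⟩ − (μ/2)‖u − x‖² + ⟨g + h, x − x⁺⟩. -/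
open scoped RealInnerProductSpace

set_option autoImplicit false

theorem opg_optimality_step_bound {n : ℕ} (X : Set (EuclideanSpace ℝ (Fin n)))
    (hXne : X.Nonempty) (hXconv : Convex ℝ X) (hXcomp : IsCompact X)
    (f r : EuclideanSpace ℝ (Fin n) → ℝ)
    (hfconv : ConvexOn ℝ X f) (hrconv : ConvexOn ℝ X r)
    (μ : ℝ) (hμ : 0 ≤ μ) (hfstrong : StronglyConvexOnSet X f μ)
    (x xp : EuclideanSpace ℝ (Fin n)) (hx : x ∈ X) (hxp : xp ∈ X)
    (η : ℝ) (hη : 0 < η)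
    (g : EuclideanSpace ℝ (Fin n)) (hg : IsSubgrad X f x g)
    (h : EuclideanSpace ℝ (Fin n)) (hh : IsSubgrad X r x h)
    (hp : EuclideanSpace ℝ (Fin n)) (hhp : IsSubgrad X r xp hp)
    (hopt : ∀ y ∈ X, 0 ≤ ⟪y - xp, g + hp + (1 / η) • (xp - x)⟫) :
    ∀ u ∈ X,
      f x + r x - f u - r u ≤
        1 / η * ⟪xp - x, u - xp⟫ - μ / 2 * ‖u - x‖ ^ 2 + ⟪g + h, x - xp⟫ := by
  intro u hu
  have hf := hfstrong x hx u hu g hg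
  have hr := hh xp hxp
  have hrp := hhp u hu
  have ho := hopt u hu
  rw [real_inner_comm, inner_add_left, inner_add_left, real_inner_smul_left] at ho
  have hgsplit : ⟪g, u - x⟫ = ⟪g, u - xp⟫ - ⟪g, x - xp⟫ := by
    rw [← inner_sub_right, sub_sub_sub_cancel_right]
  have hflip : ⟪h, xp - x⟫ = -⟪h, x - xp⟫ := by
    rw [← inner_neg_right, neg_sub]
  rw [inner_add_left]
  linarith
end

section
/- Let x, x⁺ ∈ X, η > 0, let g be a subgradient of f at x where f is μ-strongly convex on X (μ ≥ 0), let h be a subgradient of r at x and h⁺ a subgradient of r at x⁺, and assume the first-order optimality condition: for all y ∈ X, 0 ≤ ⟨y − x⁺, g + h⁺ + (1/η)(x⁺ − x)⟩. Then for every u ∈ X, f(x) + r(x) − f(u) − r(u) ≤ (1/(2η))(‖u − x‖² − ‖u − x⁺‖² − ‖x⁺ − x‖²) − (μ/2)‖u − x‖² + ⟨g + h, x − x⁺⟩. -/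
open scoped RealInnerProductSpace

set_option autoImplicit false

theorem opg_optimality_step_bound_norms {n : ℕ} (X : Set (EuclideanSpace ℝ (Fin n)))
    (hXne : X.Nonempty) (hXconv : Convex ℝ X) (hXcomp : IsCompact X)
    (f r : EuclideanSpace ℝ (Fin n) → ℝ)
    (hfconv : ConvexOn ℝ X f) (hrconv : ConvexOn ℝ X r)
    (μ : ℝ) (hμ : 0 ≤ μ) (hfstrong : StronglyConvexOnSet X f μ)
    (x xp : EuclideanSpace ℝ (Fin n)) (hx : x ∈ X) (hxp : xp ∈ X)
    (η : ℝ) (hη : 0 < η)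
    (g : EuclideanSpace ℝ (Fin n)) (hg : IsSubgrad X f x g)
    (h : EuclideanSpace ℝ (Fin n)) (hh : IsSubgrad X r x h)
    (hp : EuclideanSpace ℝ (Fin n)) (hhp : IsSubgrad X r xp hp)
    (hopt : ∀ y ∈ X, 0 ≤ ⟪y - xp, g + hp + (1 / η) • (xp - x)⟫) :
    ∀ u ∈ X,
      f x + r x - f u - r u ≤
        1 / (2 * η) * (‖u - x‖ ^ 2 - ‖u - xp‖ ^ 2 - ‖xp - x‖ ^ 2) -
          μ / 2 * ‖u - x‖ ^ 2 + ⟪g + h, x - xp⟫ := by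
  intro u hu
  have hf := hfstrong x hx u hu g hg
  have hr := hh xp hxp
  have hrp := hhp u hu
  have ho := hopt u hu
  have hsq : ‖u - x‖ ^ 2 = ‖u - xp‖ ^ 2 + 2 * ⟪u - xp, xp - x⟫ + ‖xp - x‖ ^ 2 := by
    rw [← norm_add_sq_real, sub_add_sub_cancel]
  have hprox : 1 / (2 * η) * (‖u - x‖ ^ 2 - ‖u - xp‖ ^ 2 - ‖xp - x‖ ^ 2) =
      1 / η * ⟪u - xp, xp - x⟫ := by
    rw [hsq]
    field_simp
    ring
  rw [hprox]
  simp only [inner_add_right, inner_add_left, inner_smul_right, inner_sub_right] at *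
  rw [real_inner_comm g, real_inner_comm hp] at ho
  simp only [inner_sub_right] at ho
  linarith
end
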